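/- arXiv:1304.7161 — 6 statements merged into one kernel-verified Lean document; each statement's English description precedes it below -/
import Mathlib

section
/- Let c be an integer with gcd(c,6)=1, let M ≥ 1 be an integer, and let x be an integer. Then the rational number B₂cM(x) = (M/2)·(c²·B₂({x/M}) − B₂({c·x/M})) is an integer (i.e. lies in the image of ℤ in ℚ). -/
/-- The second Bernoulli polynomial `B₂(y) = y² − y + 1/6`. -/
noncomputable def B2 (y : ℚ) : ℚ := y ^ 2 - y + 1 / 6

/-- `B₂cM(x) = (M/2)·(c²·B₂({x/M}) − B₂({c·x/M}))`. -/
noncomputable def B2c (c M x : ℤ) : ℚ :=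
  ((M : ℚ) / 2) * ((c : ℚ) ^ 2 * B2 (Int.fract ((x : ℚ) / (M : ℚ))) -
    B2 (Int.fract (((c * x : ℤ) : ℚ) / (M : ℚ))))

theorem twentyfour_dvd_sq_sub_one {c : ℤ} (hc : Int.gcd c 6 = 1) : (24 : ℤ) ∣ c ^ 2 - 1 := by
  have h2 : ¬ (2 : ℤ) ∣ c := fun h => by
    have := Int.dvd_coe_gcd h (show (2 : ℤ) ∣ 6 by norm_num)
    rw [hc] at this
    norm_num at this
  have h3 : ¬ (3 : ℤ) ∣ c := fun h => by
    have := Int.dvd_coe_gcd h (show (3 : ℤ) ∣ 6 by norm_num)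
    rw [hc] at this
    norm_num at this
  have h8 : (8 : ℤ) ∣ c ^ 2 - 1 := Int.eight_dvd_sq_sub_one_of_odd
    (Int.not_even_iff_odd.mp fun h => h2 h.two_dvd)
  have h3' : (3 : ℤ) ∣ c ^ 2 - 1 := by
    have : c % 3 = 1 ∨ c % 3 = 2 := by omega
    apply Int.dvd_of_emod_eq_zero
    rcases this with h | h <;> simp [pow_two, Int.sub_emod, Int.mul_emod, h]
  omega

theorem fract_intCast_div_intCast (x : ℤ) {M : ℤ} (hM : 0 ≤ M) :
    Int.fract ((x : ℚ) / (M : ℚ)) = ((x % M : ℤ) : ℚ) / (M : ℚ) := by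
  lift M to ℕ using hM
  exact_mod_cast Int.fract_div_intCast_eq_div_intCast_mod (k := ℚ) (m := x) (n := M)

/-- For `gcd(c,6) = 1` and `M ≥ 1`, the rational number `B₂cM(x)` is an integer. -/
theorem stmt0 (c M x : ℤ) (hc : Int.gcd c 6 = 1) (hM : 1 ≤ M) :
    ∃ n : ℤ, (n : ℚ) = B2c c M x := by
  obtain ⟨k, hk⟩ := twentyfour_dvd_sq_sub_one hc
  have hM0 : (M : ℚ) ≠ 0 := by exact_mod_cast (by omega : M ≠ 0)
  rw [B2c, fract_intCast_div_intCast _ (by omega), fract_intCast_div_intCast _ (by omega)]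
  set r := x % M
  set s := c * x % M
  obtain ⟨q, hq⟩ : ∃ q : ℤ, c * r = M * q + s := by
    refine ⟨c * x / M - c * (x / M), ?_⟩
    linear_combination c * Int.emod_add_mul_ediv x M - Int.emod_add_mul_ediv (c * x) M
  obtain ⟨u, hu⟩ := (Int.even_mul_pred_self q).two_dvd
  obtain ⟨v, hv⟩ := (Int.even_mul_pred_self c).two_dvd
  refine ⟨M * u + q * s - v * r + 2 * M * k, ?_⟩
  have hs' : (s : ℚ) = c * r - M * q := by exact_mod_cast (by linarith : s = c * r - M * q)
  have hu' : (u : ℚ) = q * (q - 1) / 2 := by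
    have : (q : ℚ) * (q - 1) = 2 * u := by exact_mod_cast hu
    linarith
  have hv' : (v : ℚ) = c * (c - 1) / 2 := by
    have : (c : ℚ) * (c - 1) = 2 * v := by exact_mod_cast hv
    linarith
  have hk' : (k : ℚ) = (c ^ 2 - 1) / 24 := by
    have : (c : ℚ) ^ 2 - 1 = 24 * k := by exact_mod_cast hk
    linarith
  push_cast
  rw [B2, B2, hu', hv', hk', hs']
  field_simp
  ring
end

section
/- Let c, M, m be integers with M ≥ 1, m ≥ 1 and gcd(c,m)=1, and let x be an integer. Then, as an identity of rational numbers, ∑_{j=0}^{m−1} B₂c(mM)(x + j·M) = B₂cM(x), where B₂c(mM) and B₂cM denote the function B₂c formed with modulus mM and M respectively. -/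
/-- The values of a function on `ℤ` with period `n`, summed over a complete residue system, are
unchanged by an invertible affine substitution modulo `n`. -/
theorem sum_range_affine_of_periodic {A : Type*} [AddCommMonoid A] (n : ℕ) [NeZero n]
    (f : ℤ → A) (hf : Function.Periodic f (n : ℤ)) (a b : ℤ) (ha : IsCoprime a (n : ℤ)) :
    ∑ j ∈ Finset.range n, f (a * j + b) = ∑ j ∈ Finset.range n, f j := by
  set g : ZMod n → A := fun z => f (z.val : ℤ) with hg
  have hfg (k : ℤ) : f k = g (k : ZMod n) := by
    simp only [hg, ZMod.val_intCast]
    conv_lhs => rw [← Int.emod_add_mul_ediv k n, mul_comm]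
    exact hf.int_mul _ _
  have hsum (h : ZMod n → A) : ∑ j ∈ Finset.range n, h (j : ZMod n) = ∑ z, h z := by
    refine Finset.sum_bij (fun j _ => (j : ZMod n)) (by simp) ?_ ?_ (by simp)
    · intro i hi j hj hij
      rw [Finset.mem_range] at hi hj
      simpa [ZMod.val_natCast, Nat.mod_eq_of_lt hi, Nat.mod_eq_of_lt hj] using
        congrArg ZMod.val hij
    · intro z _
      exact ⟨z.val, Finset.mem_range.mpr z.val_lt, ZMod.natCast_zmod_val z⟩
  have hbij : Function.Bijective fun z : ZMod n => (a : ZMod n) * z + b := by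
    refine Finite.injective_iff_bijective.mp fun z w hzw => ?_
    obtain ⟨u, v, huv⟩ := ha
    have hu : (u : ZMod n) * a = 1 := by
      simpa using congrArg (Int.cast : ℤ → ZMod n) huv
    have h := congrArg ((u : ZMod n) * ·) (add_right_cancel hzw)
    simpa [← mul_assoc, hu] using h
  have hl := hsum fun z => g ((a : ZMod n) * z + b)
  have hr := hsum g
  simp only [hfg]
  push_cast
  rw [hl, hr]
  exact hbij.sum_comp g

theorem sum_range_B2 (n : ℕ) (hn : n ≠ 0) (y : ℚ) :
    ∑ j ∈ Finset.range n, B2 ((y + j) / n) = B2 y / n := by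
  have hn' : (n : ℚ) ≠ 0 := by exact_mod_cast hn
  have key (N : ℚ) (hN : N ≠ 0) (k : ℕ) : ∑ j ∈ Finset.range k, B2 ((y + j) / N) =
      (k * y ^ 2 + y * k * (k - 1) + k * (k - 1) * (2 * k - 1) / 6) / N ^ 2
        - (k * y + k * (k - 1) / 2) / N + k / 6 := by
    induction k with
    | zero => simp
    | succ k ih =>
      rw [Finset.sum_range_succ, ih, B2]
      push_cast
      field_simp
      ring
  rw [key n hn', B2]
  field_simp
  ring

/-- The multiplication formula for the periodic second Bernoulli function, summed over any
arithmetic progression whose difference is invertible modulo `n`. -/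
theorem sum_range_B2_fract (n : ℕ) (hn : n ≠ 0) (a : ℤ) (ha : IsCoprime a (n : ℤ)) (y : ℚ) :
    ∑ j ∈ Finset.range n, B2 (Int.fract ((y + a * j) / n)) = B2 (Int.fract y) / n := by
  have : NeZero n := ⟨hn⟩
  have hn' : (0 : ℚ) < n := by exact_mod_cast Nat.pos_of_ne_zero hn
  have hper : Function.Periodic (fun k : ℤ => B2 (Int.fract ((Int.fract y + k) / n))) (n : ℤ) := by
    intro k
    have h : (Int.fract y + ((k + n : ℤ) : ℚ)) / n = (Int.fract y + k) / n + 1 := by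
      push_cast
      field_simp
      ring
    simp only [h, Int.fract_add_one]
  have h := sum_range_affine_of_periodic n _ hper a ⌊y⌋ ha
  rw [← sum_range_B2 n hn]
  calc
    _ = ∑ j ∈ Finset.range n, B2 (Int.fract ((Int.fract y + ((a * j + ⌊y⌋ : ℤ) : ℚ)) / n)) := by
      refine Finset.sum_congr rfl fun j _ => ?_
      congr 3
      push_cast
      linarith [Int.fract_add_floor y]
    _ = ∑ j ∈ Finset.range n, B2 (Int.fract ((Int.fract y + ((j : ℤ) : ℚ)) / n)) := h
    _ = _ := by
      refine Finset.sum_congr rfl fun j hj => ?_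
      have hj' : (j : ℚ) + 1 ≤ n := by exact_mod_cast Finset.mem_range.mp hj
      have h0 := Int.fract_nonneg y
      have h1 := Int.fract_lt_one y
      rw [Int.cast_natCast, Int.fract_eq_self.mpr]
      exact ⟨by positivity, (div_lt_one hn').mpr (by linarith)⟩

/-- Distribution relation: `∑_{j=0}^{m−1} B₂c(mM)(x + j·M) = B₂cM(x)`. -/
theorem stmt1 (c M m x : ℤ) (hM : 1 ≤ M) (hm : 1 ≤ m) (hcm : Int.gcd c m = 1) :
    ∑ j ∈ Finset.range m.toNat, B2c c (m * M) (x + (j : ℤ) * M) = B2c c M x := by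
  lift m to ℕ using by lia
  have hm0 : m ≠ 0 := by lia
  have hmQ : (m : ℚ) ≠ 0 := by exact_mod_cast hm0
  have hMQ : (M : ℚ) ≠ 0 := by exact_mod_cast (by lia : M ≠ 0)
  have h₁ := sum_range_B2_fract m hm0 1 isCoprime_one_left ((x : ℚ) / M)
  have h₂ := sum_range_B2_fract m hm0 c (Int.isCoprime_iff_gcd_eq_one.mpr hcm)
    (((c * x : ℤ) : ℚ) / M)
  have e₁ (j : ℕ) : ((x + (j : ℤ) * M : ℤ) : ℚ) / (((m : ℤ) * M : ℤ) : ℚ) =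
      ((x : ℚ) / M + (1 : ℤ) * j) / m := by
    push_cast
    field_simp
  have e₂ (j : ℕ) : ((c * (x + (j : ℤ) * M) : ℤ) : ℚ) / (((m : ℤ) * M : ℤ) : ℚ) =
      (((c * x : ℤ) : ℚ) / M + c * j) / m := by
    push_cast
    field_simp
  simp only [B2c, e₁, e₂, Int.toNat_natCast]
  rw [← Finset.mul_sum, Finset.sum_sub_distrib, ← Finset.mul_sum, h₁, h₂]
  push_cast
  field_simp
end

section
/- Let ℓ be a prime, let N ≥ 1, k ≥ 0 and t be integers, and let c be an integer with gcd(c, 6ℓ) = 1. For r ≥ 0 set S_r := ∑ B₂c(ℓʳN)(x)·x^k, the sum over all integers x with 0 ≤ x < ℓʳ·N and x ≡ t (mod N). Then for every r ≥ 0 one has S_{r+1} − S_r ∈ ℓʳ·N·ℤ, i.e. the difference is an integer divisible by ℓʳ·N; in particular the sequence (S_r) is an ℓ-adic Cauchy sequence. -/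
/-- `S_r = ∑_{0 ≤ x < ℓʳN, x ≡ t mod N} B₂c(ℓʳN)(x)·x^k`. -/
noncomputable def S (ℓ N k : ℕ) (t c : ℤ) (r : ℕ) : ℚ :=
  ∑ x ∈ (Finset.Ico (0 : ℤ) ((ℓ : ℤ) ^ r * (N : ℤ))).filter
      (fun x => x % (N : ℤ) = t % (N : ℤ)),
    B2c c ((ℓ : ℤ) ^ r * (N : ℤ)) x * (x : ℚ) ^ k

/-- The second Bernoulli distribution `x ↦ (M/2)·B₂({x/M})` on `ℤ/Mℤ`. -/
noncomputable def bernoulliDist (M x : ℤ) : ℚ :=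
  ((M : ℚ) / 2) * B2 (Int.fract ((x : ℚ) / (M : ℚ)))

theorem B2c_eq_bernoulliDist (c M x : ℤ) :
    B2c c M x = (c : ℚ) ^ 2 * bernoulliDist M x - bernoulliDist M (c * x) := by
  unfold B2c bernoulliDist
  ring

theorem bernoulliDist_add_mul {M : ℤ} (hM : M ≠ 0) (x q : ℤ) :
    bernoulliDist M (x + q * M) = bernoulliDist M x := by
  have hM' : (M : ℚ) ≠ 0 := by exact_mod_cast hM
  have h : ((x + q * M : ℤ) : ℚ) / M = (x : ℚ) / M + (q : ℤ) := by
    push_cast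
    field_simp
  rw [bernoulliDist, h, Int.fract_add_intCast, bernoulliDist]

theorem bernoulliDist_of_mem {M x : ℤ} (h0 : 0 ≤ x) (h1 : x < M) :
    bernoulliDist M x = (M : ℚ) / 2 * B2 ((x : ℚ) / M) := by
  have hM : (0 : ℚ) < M := by exact_mod_cast h0.trans_lt h1
  have hx : (0 : ℚ) ≤ x := by exact_mod_cast h0
  have hxM : (x : ℚ) < M := by exact_mod_cast h1
  rw [bernoulliDist, Int.fract_eq_self.2 ⟨by positivity, (div_lt_one hM).2 hxM⟩]

theorem sum_range_quadratic (a b d : ℚ) (n : ℕ) :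
    ∑ j ∈ Finset.range n, (a + b * j + d * (j : ℚ) ^ 2) =
      a * n + b * (n * (n - 1) / 2) + d * (n * (n - 1) * (2 * n - 1) / 6) := by
  induction n with
  | zero => simp
  | succ n ih =>
    rw [Finset.sum_range_succ, ih]
    push_cast
    ring

theorem sum_Ico_eq_sum_range (n : ℕ) (f : ℤ → ℚ) :
    ∑ j ∈ Finset.Ico (0 : ℤ) n, f j = ∑ j ∈ Finset.range n, f j := by
  refine Finset.sum_nbij' Int.toNat (fun j : ℕ => (j : ℤ)) ?_ ?_ ?_ ?_ ?_
  · intro j hj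
    simp only [Finset.mem_Ico, Finset.mem_range] at *
    omega
  · intro j hj
    simp only [Finset.mem_Ico, Finset.mem_range] at *
    omega
  · intro j hj
    exact Int.toNat_of_nonneg (Finset.mem_Ico.1 hj).1
  · intro j _
    exact Int.toNat_natCast j
  · intro j hj
    rw [Int.toNat_of_nonneg (Finset.mem_Ico.1 hj).1]

/-- An affine bijection of `ℤ/nℤ` does not change the sum of an `n`-periodic function. -/
theorem sum_affine_of_periodic {n c : ℤ} (hn : 0 < n) (hc : IsCoprime n c) (q : ℤ) (g : ℤ → ℚ)
    (hg : ∀ j m, g (j + m * n) = g j) :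
    ∑ j ∈ Finset.Ico 0 n, g (q + c * j) = ∑ j ∈ Finset.Ico 0 n, g j := by
  have hmaps : Set.MapsTo (fun j => (q + c * j) % n) (Finset.Ico 0 n : Finset ℤ)
      (Finset.Ico 0 n : Finset ℤ) := fun j _ => by
    simpa using ⟨Int.emod_nonneg _ hn.ne', Int.emod_lt_of_pos _ hn⟩
  have hinj : Set.InjOn (fun j => (q + c * j) % n) (Finset.Ico 0 n : Finset ℤ) := by
    intro i hi j hj hij
    simp only [Finset.coe_Ico, Set.mem_Ico] at hi hj
    have hdvd : n ∣ c * (j - i) := by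
      have h := Int.ModEq.dvd (hij : q + c * i ≡ q + c * j [ZMOD n])
      convert h using 1
      ring
    have hmod : i ≡ j [ZMOD n] := (Int.modEq_iff_dvd).2 (hc.dvd_of_dvd_mul_left hdvd)
    rw [← Int.emod_eq_of_lt hi.1 hi.2, ← Int.emod_eq_of_lt hj.1 hj.2]
    exact hmod
  refine Finset.sum_nbij (fun j => (q + c * j) % n) hmaps hinj
    (Finset.surjOn_of_injOn_of_card_le _ hmaps hinj le_rfl) fun j _ => ?_
  rw [← hg ((q + c * j) % n) ((q + c * j) / n), mul_comm (_ / n) n, Int.emod_add_mul_ediv]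

/-- The distribution relation for representatives `0 ≤ x < M`. -/
theorem sum_bernoulliDist_of_mem {n : ℕ} (hn : 0 < n) {M x : ℤ} (h0 : 0 ≤ x) (h1 : x < M) :
    ∑ j ∈ Finset.Ico (0 : ℤ) n, bernoulliDist (n * M) (x + j * M) = bernoulliDist M x := by
  have hM : 0 < M := h0.trans_lt h1
  have hM' : (M : ℚ) ≠ 0 := by exact_mod_cast hM.ne'
  have hn' : (n : ℚ) ≠ 0 := by exact_mod_cast hn.ne'
  have hterm : ∀ j ∈ Finset.Ico (0 : ℤ) n, bernoulliDist (n * M) (x + j * M) =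
      ((x : ℚ) ^ 2 / (2 * n * M) - x / 2 + n * M / 12) + (x / n - M / 2) * j +
        M / (2 * n) * (j : ℚ) ^ 2 := by
    intro j hj
    rw [Finset.mem_Ico] at hj
    rw [bernoulliDist_of_mem (by nlinarith) (by nlinarith), B2]
    push_cast
    field_simp
    ring
  rw [Finset.sum_congr rfl hterm, sum_Ico_eq_sum_range n fun j => ((x : ℚ) ^ 2 / (2 * n * M)
    - x / 2 + n * M / 12) + (x / n - M / 2) * j + M / (2 * n) * (j : ℚ) ^ 2]
  simp only [Int.cast_natCast]
  rw [sum_range_quadratic, bernoulliDist_of_mem h0 h1, B2]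
  field_simp
  ring

theorem sum_bernoulliDist {n : ℕ} (hn : 0 < n) {M c : ℤ} (hM : 0 < M) (hc : IsCoprime (n : ℤ) c)
    (x : ℤ) :
    ∑ j ∈ Finset.Ico (0 : ℤ) n, bernoulliDist (n * M) (x + c * j * M) = bernoulliDist M x := by
  have hn' : (0 : ℤ) < n := by exact_mod_cast hn
  have hx : x % M + x / M * M = x := by rw [mul_comm, Int.emod_add_mul_ediv]
  have hper : ∀ j m : ℤ, bernoulliDist (n * M) (x % M + (j + m * n) * M) =
      bernoulliDist (n * M) (x % M + j * M) := by
    intro j m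
    rw [← bernoulliDist_add_mul (by positivity : (n * M : ℤ) ≠ 0) (x % M + j * M) m]
    ring_nf
  have h := sum_affine_of_periodic hn' hc (x / M)
    (fun j => bernoulliDist (n * M) (x % M + j * M)) hper
  rw [sum_bernoulliDist_of_mem hn (Int.emod_nonneg _ hM.ne') (Int.emod_lt_of_pos _ hM)] at h
  rw [← hx, bernoulliDist_add_mul hM.ne', ← h, hx]
  refine Finset.sum_congr rfl fun j _ => ?_
  congr 1
  linear_combination -hx

/-- The distribution relation for `B2c`. -/
theorem sum_B2c {n : ℕ} (hn : 0 < n) {M c : ℤ} (hM : 0 < M) (hc : IsCoprime (n : ℤ) c) (x : ℤ) :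
    ∑ j ∈ Finset.Ico (0 : ℤ) n, B2c c (n * M) (x + j * M) = B2c c M x := by
  simp only [B2c_eq_bernoulliDist, Finset.sum_sub_distrib, ← Finset.mul_sum]
  have h1 := sum_bernoulliDist hn hM isCoprime_one_right x
  have h2 := sum_bernoulliDist hn hM hc (c * x)
  simp only [one_mul] at h1
  simp only [mul_add, ← mul_assoc] at h2 ⊢
  rw [h1, h2]

theorem exists_int_eq_B2c {c M : ℤ} (hM : M ≠ 0) (hc : IsCoprime c 6) (x : ℤ) :
    ∃ z : ℤ, B2c c M x = z := by
  have hM' : (M : ℚ) ≠ 0 := by exact_mod_cast hM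
  have h12 : (12 : ℤ) ∣ c ^ 2 - 1 := by
    have h2 : ¬ (2 : ℤ) ∣ c := fun h => by
      have := hc.isUnit_of_dvd' h (by norm_num)
      norm_num [Int.isUnit_iff] at this
    have h3 : ¬ (3 : ℤ) ∣ c := fun h => by
      have := hc.isUnit_of_dvd' h (by norm_num)
      norm_num [Int.isUnit_iff] at this
    have h : c % 12 = 1 ∨ c % 12 = 5 ∨ c % 12 = 7 ∨ c % 12 = 11 := by omega
    apply Int.dvd_of_emod_eq_zero
    rcases h with h | h | h | h <;> simp [pow_two, Int.sub_emod, Int.mul_emod, h]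
  obtain ⟨a, ha⟩ := h12
  obtain ⟨b, hb⟩ := even_iff_two_dvd.1 (Int.even_mul_pred_self c)
  set p : ℤ := ⌊(x : ℚ) / M⌋
  set q : ℤ := ⌊((c * x : ℤ) : ℚ) / M⌋
  obtain ⟨d, hd⟩ := even_iff_two_dvd.1 (Int.even_mul_succ_self q)
  obtain ⟨e, he⟩ := even_iff_two_dvd.1 (Int.even_mul_succ_self p)
  have haQ : (c : ℚ) ^ 2 - 1 = 12 * a := by exact_mod_cast ha
  have hbQ : (c : ℚ) * (c - 1) = 2 * b := by exact_mod_cast hb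
  have hdQ : (q : ℚ) * (q + 1) = 2 * d := by exact_mod_cast hd
  have heQ : (p : ℚ) * (p + 1) = 2 * e := by exact_mod_cast he
  refine ⟨M * a - b * x - c ^ 2 * x * p + M * c ^ 2 * e + c * x * q - M * d, ?_⟩
  rw [B2c, Int.fract, Int.fract, B2, B2]
  push_cast
  have hd' : (d : ℚ) = q * (q + 1) / 2 := by linarith
  have he' : (e : ℚ) = p * (p + 1) / 2 := by linarith
  have hb' : (b : ℚ) = c * (c - 1) / 2 := by linarith
  have ha' : (a : ℚ) = (c ^ 2 - 1) / 12 := by linarith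
  rw [ha', hb', hd', he']
  change (M : ℚ) / 2 * (c ^ 2 * (((x : ℚ) / M - p) ^ 2 - (x / M - p) + 1 / 6) -
    ((c * x / M - (⌊(c : ℚ) * x / M⌋ : ℤ)) ^ 2 - (c * x / M - (⌊(c : ℚ) * x / M⌋ : ℤ)) + 1 / 6)) = _
  have hq : ⌊(c : ℚ) * x / M⌋ = q := by simp only [q, Int.cast_mul]
  rw [hq]
  field_simp
  ring

theorem sum_Ico_filter_mul {n : ℕ} {M N t : ℤ} (hM : 0 < M) (hNM : N ∣ M)
    (f : ℤ → ℚ) :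
    ∑ y ∈ (Finset.Ico (0 : ℤ) (n * M)).filter (fun y => y % N = t % N), f y =
      ∑ x ∈ (Finset.Ico (0 : ℤ) M).filter (fun x => x % N = t % N),
        ∑ j ∈ Finset.Ico (0 : ℤ) n, f (x + j * M) := by
  have hmod : ∀ x j : ℤ, (x + j * M) % N = x % N := fun x j => by
    obtain ⟨d, rfl⟩ := hNM
    rw [mul_left_comm, Int.add_mul_emod_self_left]
  have hdiv : ∀ y : ℤ, y % M + y / M * M = y := fun y => by
    rw [mul_comm, Int.emod_add_mul_ediv]
  rw [← Finset.sum_product']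
  refine Finset.sum_nbij' (fun y => (y % M, y / M)) (fun z => z.1 + z.2 * M) ?_ ?_ ?_ ?_ ?_
  · intro y hy
    simp only [Finset.mem_filter, Finset.mem_Ico, Finset.mem_product] at hy ⊢
    refine ⟨⟨⟨Int.emod_nonneg _ hM.ne', Int.emod_lt_of_pos _ hM⟩, ?_⟩,
      Int.ediv_nonneg hy.1.1 hM.le, Int.ediv_lt_of_lt_mul hM hy.1.2⟩
    rw [← hmod (y % M) (y / M), hdiv, hy.2]
  · rintro ⟨x, j⟩ hz
    simp only [Finset.mem_filter, Finset.mem_Ico, Finset.mem_product] at hz ⊢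
    exact ⟨⟨by nlinarith, by nlinarith⟩, (hmod x j).trans hz.1.2⟩
  · intro y _
    exact hdiv y
  · rintro ⟨x, j⟩ hz
    simp only [Finset.mem_filter, Finset.mem_Ico, Finset.mem_product] at hz
    have hx : x % M = x := Int.emod_eq_of_lt hz.1.1.1 hz.1.1.2
    have hj : x / M = 0 := Int.ediv_eq_zero_of_lt hz.1.1.1 hz.1.1.2
    simp [Int.add_mul_ediv_right _ _ hM.ne', hx, hj]
  · intro y _
    rw [hdiv]

/-- The rational numbers in `m·ℤ` are closed under finite sums. -/
theorem exists_sum_eq_mul_int {ι : Type*} (s : Finset ι) (f : ι → ℚ) (m : ℚ)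
    (h : ∀ i ∈ s, ∃ z : ℤ, f i = m * z) : ∃ z : ℤ, ∑ i ∈ s, f i = m * z := by
  choose! g hg using h
  exact ⟨∑ i ∈ s, g i, by rw [Finset.sum_congr rfl hg, ← Finset.mul_sum, Int.cast_sum]⟩

/-- The differences `S_{r+1} − S_r` lie in `ℓʳ·N·ℤ`, so `(S_r)` is an ℓ-adic Cauchy
sequence. -/
theorem stmt2 (ℓ : ℕ) (hℓ : ℓ.Prime) (N : ℕ) (hN : 1 ≤ N) (k : ℕ) (t c : ℤ)
    (hc : Int.gcd c (6 * ℓ) = 1) (r : ℕ) :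
    ∃ z : ℤ, S ℓ N k t c (r + 1) - S ℓ N k t c r = ((ℓ : ℚ) ^ r * (N : ℚ)) * (z : ℚ) := by
  have hℓ0 : (0 : ℤ) < ℓ := by exact_mod_cast hℓ.pos
  have hN0 : (0 : ℤ) < N := by exact_mod_cast hN
  have hc' : IsCoprime c (6 * ℓ) := Int.isCoprime_iff_gcd_eq_one.2 hc
  have hc6 : IsCoprime c 6 := hc'.of_mul_right_left
  have hcℓ : IsCoprime (ℓ : ℤ) c := hc'.of_mul_right_right.symm
  have hM : (0 : ℤ) < (ℓ : ℤ) ^ r * N := by positivity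
  have hS : (ℓ : ℤ) ^ (r + 1) * N = ℓ * ((ℓ : ℤ) ^ r * N) := by ring
  have hcast : ((ℓ : ℚ) ^ r * (N : ℚ)) = (((ℓ : ℤ) ^ r * N : ℤ) : ℚ) := by push_cast; rfl
  rw [S, S, hS, hcast]
  generalize hMdef : (ℓ : ℤ) ^ r * (N : ℤ) = M at hM
  rw [sum_Ico_filter_mul hM (hMdef ▸ dvd_mul_left _ _), ← Finset.sum_sub_distrib]
  refine exists_sum_eq_mul_int _ _ _ fun x _ => ?_
  rw [← sum_B2c hℓ.pos hM hcℓ x, Finset.sum_mul, ← Finset.sum_sub_distrib]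
  refine exists_sum_eq_mul_int _ _ _ fun j _ => ?_
  obtain ⟨b, hb⟩ := exists_int_eq_B2c (mul_pos hℓ0 hM).ne' hc6 (x + j * M)
  obtain ⟨d, hd⟩ : M ∣ (x + j * M) ^ k - x ^ k :=
    dvd_trans ⟨j, by ring⟩ (sub_dvd_pow_sub_pow (x + j * M) x k)
  have hdQ : ((x + j * M : ℤ) : ℚ) ^ k - (x : ℚ) ^ k = M * d := by exact_mod_cast hd
  refine ⟨b * d, ?_⟩
  rw [hb, ← mul_sub, hdQ]
  push_cast
  ring
end

section
/- Let ℓ be a prime, let N ≥ 1 and k ≥ 0 be integers, let t be an integer, and let c be an integer with gcd(c, 6ℓ) = 1. For r ≥ 0 set S_r := ∑ B₂c(ℓʳN)(x)·x^k, the sum over all integers x with 0 ≤ x < ℓʳ·N and x ≡ t (mod N). Then, viewing rational numbers inside the field ℚ_ℓ of ℓ-adic numbers, the sequence (S_r) converges in ℚ_ℓ to (N^{k+1}/(c^k·(k+2)))·( c^{k+2}·B_{k+2}({t/N}) − B_{k+2}({c·t/N}) ), where B_{k+2} is the (k+2)-nd Bernoulli polynomial evaluated at the indicated rational numbers. -/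
open Filter Topology in
/-- The divided differences of a polynomial along a null sequence converge to its derivative. -/
theorem Polynomial.tendsto_divided_difference {𝕜 : Type*} [NontriviallyNormedField 𝕜]
    (p : Polynomial 𝕜) (a : 𝕜) {h : ℕ → 𝕜} (hh : Tendsto h atTop (𝓝 0)) (h0 : ∀ r, h r ≠ 0) :
    Tendsto (fun r => (p.eval (a + h r) - p.eval a) / h r) atTop (𝓝 (p.derivative.eval a)) := by
  have := (hasDerivAt_iff_tendsto_slope_zero.1 (p.hasDerivAt a)).comp
    (tendsto_nhdsWithin_iff.2 ⟨hh, Eventually.of_forall h0⟩)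
  refine this.congr fun r => ?_
  simp [div_eq_inv_mul]

theorem sum_range_add_pow_eq_bernoulli_sub (a : ℚ) (m L : ℕ) :
    ∑ y ∈ Finset.range L, (a + y) ^ m =
      ((Polynomial.bernoulli (m + 1)).eval (a + L) - (Polynomial.bernoulli (m + 1)).eval a) /
        (m + 1) := by
  have hm : (m : ℚ) + 1 ≠ 0 := by positivity
  induction L with
  | zero => simp
  | succ L ih =>
    have h := Polynomial.bernoulli_eval_one_add (m + 1) (a + L)
    rw [Finset.sum_range_succ, ih, Nat.cast_succ, show a + ((L : ℚ) + 1) = 1 + (a + L) by ring, h]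
    push_cast
    field_simp
    ring_nf

theorem sum_range_add_mul_pow_eq_bernoulli_sub {N : ℕ} (hN : 1 ≤ N) (s : ℤ) (m L : ℕ) :
    ∑ y ∈ Finset.range L, (((s + N * y : ℤ) : ℚ)) ^ m =
      (N : ℚ) ^ m * (((Polynomial.bernoulli (m + 1)).eval ((s : ℚ) / N + L) -
        (Polynomial.bernoulli (m + 1)).eval ((s : ℚ) / N)) / (m + 1)) := by
  have hN0 : (N : ℚ) ≠ 0 := by positivity
  rw [← sum_range_add_pow_eq_bernoulli_sub, Finset.mul_sum]
  refine Finset.sum_congr rfl fun y _ => ?_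
  rw [← mul_pow]
  push_cast
  congr 1
  field_simp

/-- The integers `0 ≤ x < L * N` congruent to `t` mod `N`. -/
noncomputable def residues (L N : ℕ) (t : ℤ) : Finset ℤ :=
  (Finset.Ico (0 : ℤ) (L * N)).filter (fun x => x % (N : ℤ) = t % (N : ℤ))

theorem mem_residues {L N : ℕ} {t x : ℤ} :
    x ∈ residues L N t ↔ (0 ≤ x ∧ x < L * N) ∧ x % (N : ℤ) = t % (N : ℤ) := by
  simp [residues]

theorem residues_eq_image {N : ℕ} (hN : 1 ≤ N) (L : ℕ) (t : ℤ) :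
    residues L N t = (Finset.range L).image (fun y : ℕ => t % (N : ℤ) + N * y) := by
  have hN' : (0 : ℤ) < N := by exact_mod_cast hN
  ext x
  simp only [mem_residues, Finset.mem_image, Finset.mem_range]
  constructor
  · rintro ⟨⟨h0, hx⟩, hmod⟩
    refine ⟨(x / N).toNat, ?_, ?_⟩
    · have h1 : x / N < L := Int.ediv_lt_of_lt_mul hN' hx
      have h2 : 0 ≤ x / N := Int.ediv_nonneg h0 hN'.le
      omega
    · rw [Int.toNat_of_nonneg (Int.ediv_nonneg h0 hN'.le), ← hmod]
      exact Int.emod_add_mul_ediv x N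
  · rintro ⟨y, hy, rfl⟩
    have h0 := Int.emod_nonneg t hN'.ne'
    have h1 := Int.emod_lt_of_pos t hN'
    have hy' : (y : ℤ) + 1 ≤ L := by exact_mod_cast hy
    refine ⟨⟨by positivity, by nlinarith⟩, by simp⟩

theorem injective_add_mul {N : ℕ} (hN : 1 ≤ N) (s : ℤ) :
    Function.Injective (fun y : ℕ => s + N * (y : ℤ)) := by
  have hN' : N ≠ 0 := by positivity
  intro a b h
  simpa [hN'] using h

theorem sum_residues {N : ℕ} (hN : 1 ≤ N) (L : ℕ) (t : ℤ) (f : ℤ → ℚ) :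
    ∑ x ∈ residues L N t, f x = ∑ y ∈ Finset.range L, f (t % (N : ℤ) + N * y) := by
  rw [residues_eq_image hN, Finset.sum_image (injective_add_mul hN _).injOn]

theorem card_residues {N : ℕ} (hN : 1 ≤ N) (L : ℕ) (t : ℤ) : (residues L N t).card = L := by
  rw [residues_eq_image hN, Finset.card_image_of_injective _ (injective_add_mul hN _),
    Finset.card_range]

/-- Multiplication by a unit `c` modulo `L` carries the class of `t` mod `N` to that of `c * t`. -/
theorem sum_residues_mul {L N : ℕ} (hL : 1 ≤ L) (hN : 1 ≤ N) {c : ℤ} (hc : IsCoprime (L : ℤ) c)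
    (t : ℤ) (f : ℤ → ℚ) :
    ∑ x ∈ residues L N t, f (c * x % (L * N)) = ∑ x ∈ residues L N (c * t), f x := by
  have hM : (0 : ℤ) < L * N := by positivity
  have hN' : (N : ℤ) ≠ 0 := by positivity
  have hinj : Set.InjOn (fun x => c * x % (L * N : ℤ)) (residues L N t) := by
    intro x hx y hy hxy
    have hx := mem_residues.1 hx
    have hy := mem_residues.1 hy
    obtain ⟨j, hj⟩ : (N : ℤ) ∣ x - y := 
      Int.ModEq.dvd (show y ≡ x [ZMOD N] from hy.2.trans hx.2.symm)
    have h1 : (L * N : ℤ) ∣ c * x - c * y :=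
      Int.ModEq.dvd (show c * y ≡ c * x [ZMOD (L * N : ℤ)] from hxy.symm)
    have h2 : (L : ℤ) * N ∣ (c * j) * N := by
      convert h1 using 1
      linear_combination -c * hj
    have h3 : (L : ℤ) ∣ j := hc.dvd_of_dvd_mul_left (Int.dvd_of_mul_dvd_mul_right hN' h2)
    have h4 : (L * N : ℤ) ∣ x - y := by
      rw [hj, mul_comm (N : ℤ) j]
      exact mul_dvd_mul_right h3 _
    have h5 := Int.eq_zero_of_abs_lt_dvd h4 (by rw [abs_lt]; constructor <;> linarith)
    linarith
  have himg : (residues L N t).image (fun x => c * x % (L * N : ℤ)) = residues L N (c * t) := by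
    refine Finset.eq_of_subset_of_card_le ?_ ?_
    · intro z hz
      obtain ⟨x, hx, rfl⟩ := Finset.mem_image.1 hz
      refine mem_residues.2 ⟨⟨Int.emod_nonneg _ hM.ne', Int.emod_lt_of_pos _ hM⟩, ?_⟩
      rw [Int.emod_emod_of_dvd _ (Dvd.intro_left _ rfl)]
      exact Int.ModEq.mul_left c (mem_residues.1 hx).2
    · rw [Finset.card_image_of_injOn hinj, card_residues hN, card_residues hN]
  rw [← himg, Finset.sum_image hinj]

/-- The part of the `k`-th moment that survives in the limit. -/
noncomputable def mainTerm (M k : ℕ) (y : ℤ) : ℚ :=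
  (y : ℚ) ^ (k + 2) / M - ((k : ℚ) + 2) / 2 * (y : ℚ) ^ (k + 1)

theorem B2c_mul_pow_eq {M : ℕ} (k : ℕ) {c x : ℤ} (hc : c ≠ 0) (h0 : 0 ≤ x) (hx : x < M) :
    ∃ Z : ℤ, B2c c M x * (x : ℚ) ^ k =
      1 / ((c : ℚ) ^ k * (k + 2)) *
        ((c : ℚ) ^ (k + 2) * mainTerm M k x - mainTerm M k (c * x % M)) +
      M * Z / (12 * ((c : ℚ) ^ k * (k + 2))) := by
  have hM : (M : ℚ) ≠ 0 := by
    have : M ≠ 0 := by omega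
    exact_mod_cast this
  have hc' : (c : ℚ) ≠ 0 := by exact_mod_cast hc
  have hk : (k : ℚ) + 2 ≠ 0 := by positivity
  have hw : (c * x % M) + M * (c * x / M) = c * x := Int.emod_add_mul_ediv (c * x) M
  have hf1 : Int.fract ((x : ℚ) / ((M : ℤ) : ℚ)) = (x : ℚ) / M := by
    rw [Int.cast_natCast, Int.fract_div_intCast_eq_div_intCast_mod, Int.emod_eq_of_lt h0 hx]
  have hf2 : Int.fract (((c * x : ℤ) : ℚ) / ((M : ℤ) : ℚ)) = ((c * x % M : ℤ) : ℚ) / M := by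
    rw [Int.cast_natCast, Int.fract_div_intCast_eq_div_intCast_mod]
  unfold B2c
  rw [hf1, hf2]
  generalize c * x % M = z at *
  generalize c * x / M = q at *
  obtain ⟨A, hA⟩ := Polynomial.powAddExpansion z (M * q) k
  obtain ⟨B, hB⟩ := Polynomial.powAddExpansion z (M * q) (k + 2)
  have hz : z * (k * z ^ (k - 1)) = k * z ^ k := by
    cases k with
    | zero => simp
    | succ k => simp only [Nat.add_sub_cancel]; ring
  rw [hw, mul_pow] at hA hB
  refine ⟨c ^ (k + 2) * (k + 2) * x ^ k - 6 * (k + 2) * z ^ 2 * q ^ 2 * A +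
    6 * (k + 2) * (k * z ^ k * q + z * M * q ^ 2 * A) - (k + 2) * (c ^ k * x ^ k) +
    6 * k * q ^ 2 * B, ?_⟩
  have hA' := congrArg (Int.cast : ℤ → ℚ) hA
  have hB' := congrArg (Int.cast : ℤ → ℚ) hB
  have hz' := congrArg (Int.cast : ℤ → ℚ) hz
  simp only [show k + 2 - 1 = k + 1 from rfl] at hB'
  push_cast at hA' hB' hz' ⊢
  unfold B2 mainTerm
  generalize (z : ℚ) ^ (k - 1) = D at *
  field_simp
  linear_combination -72 * ((k : ℚ) + 2) * (z ^ 2 - M * z) * hA' + 72 * (k : ℚ) * hB' +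
    72 * ((k : ℚ) + 2) * M * q * (M - z) * hz'

theorem S_eq {ℓ N : ℕ} (hℓ : 1 ≤ ℓ) (hN : 1 ≤ N) (k : ℕ) (t : ℤ) {c : ℤ} (hc0 : c ≠ 0)
    (hc : IsCoprime (ℓ : ℤ) c) (r : ℕ) :
    ∃ Z : ℤ, S ℓ N k t c r =
      1 / ((c : ℚ) ^ k * (k + 2)) *
        ((c : ℚ) ^ (k + 2) * ∑ x ∈ residues (ℓ ^ r) N t, mainTerm (ℓ ^ r * N) k x -
          ∑ x ∈ residues (ℓ ^ r) N (c * t), mainTerm (ℓ ^ r * N) k x) +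
      (ℓ : ℚ) ^ r * (N * Z / (12 * ((c : ℚ) ^ k * (k + 2)))) := by
  have hS : S ℓ N k t c r =
      ∑ x ∈ residues (ℓ ^ r) N t, B2c c ((ℓ ^ r * N : ℕ) : ℤ) x * (x : ℚ) ^ k := by
    simp [S, residues]
  have hterm : ∀ x ∈ residues (ℓ ^ r) N t, _ := fun x hx =>
    B2c_mul_pow_eq (M := ℓ ^ r * N) k hc0 (mem_residues.1 hx).1.1
      (by exact_mod_cast (mem_residues.1 hx).1.2)
  choose! Z hZ using hterm
  refine ⟨∑ x ∈ residues (ℓ ^ r) N t, Z x, ?_⟩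
  have hcop : IsCoprime ((ℓ ^ r : ℕ) : ℤ) c := by
    push_cast
    exact hc.pow_left
  rw [hS, Finset.sum_congr rfl hZ, ← sum_residues_mul (Nat.one_le_pow _ _ hℓ) hN hcop,
    Finset.sum_add_distrib, ← Finset.mul_sum, Finset.sum_sub_distrib, ← Finset.mul_sum,
    ← Finset.sum_div, ← Finset.mul_sum]
  push_cast
  ring

open Filter Topology in
theorem tendsto_sum_mainTerm (ℓ : ℕ) [Fact ℓ.Prime] {N : ℕ} (hN : 1 ≤ N) (k : ℕ) (t : ℤ) :
    Tendsto (fun r => ((∑ x ∈ residues (ℓ ^ r) N t, mainTerm (ℓ ^ r * N) k x : ℚ) : ℚ_[ℓ])) atTop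
      (𝓝 (((N : ℚ) ^ (k + 1) *
        (Polynomial.bernoulli (k + 2)).eval (Int.fract ((t : ℚ) / (N : ℚ))) : ℚ) : ℚ_[ℓ])) := by
  have hℓ0 : (ℓ : ℚ_[ℓ]) ≠ 0 := by exact_mod_cast (Fact.out : ℓ.Prime).ne_zero
  have hpow : Tendsto (fun r : ℕ => (ℓ : ℚ_[ℓ]) ^ r) atTop (𝓝 0) :=
    tendsto_pow_atTop_nhds_zero_of_norm_lt_one Padic.norm_p_lt_one
  set a : ℚ := Int.fract ((t : ℚ) / (N : ℚ)) with ha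
  have ha' : ((t % (N : ℤ) : ℤ) : ℚ) / N = a := by
    rw [ha, Int.fract_div_intCast_eq_div_intCast_mod]
  have hdd : ∀ m : ℕ, Tendsto (fun r => ((((Polynomial.bernoulli (m + 1)).eval (a + (ℓ : ℚ) ^ r) -
      (Polynomial.bernoulli (m + 1)).eval a) / (ℓ : ℚ) ^ r / (m + 1) : ℚ) : ℚ_[ℓ])) atTop
      (𝓝 (((Polynomial.bernoulli m).eval a : ℚ) : ℚ_[ℓ])) := by
    intro m
    have hm : (m : ℚ_[ℓ]) + 1 ≠ 0 := by exact_mod_cast m.succ_ne_zero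
    have h := (((Polynomial.bernoulli (m + 1)).map (Rat.castHom ℚ_[ℓ])).tendsto_divided_difference
      (a : ℚ_[ℓ]) hpow fun r => pow_ne_zero r hℓ0).div_const ((m : ℚ_[ℓ]) + 1)
    have hev : ∀ (p : Polynomial ℚ) (b : ℚ),
        (p.map (Rat.castHom ℚ_[ℓ])).eval (b : ℚ_[ℓ]) = ((p.eval b : ℚ) : ℚ_[ℓ]) := fun p b => by
      rw [Polynomial.eval_map]
      exact Polynomial.eval₂_at_apply (Rat.castHom ℚ_[ℓ]) b
    have hadd : ∀ r : ℕ, (a : ℚ_[ℓ]) + (ℓ : ℚ_[ℓ]) ^ r = ((a + (ℓ : ℚ) ^ r : ℚ) : ℚ_[ℓ]) :=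
      fun r => by push_cast; rfl
    simp only [Polynomial.derivative_map, hadd, hev, Polynomial.derivative_bernoulli_add_one] at h
    refine (h.congr fun r => by push_cast; rfl).trans_eq ?_
    congr 1
    have : (Polynomial.eval a ((m : Polynomial ℚ) + 1)) = (m : ℚ) + 1 := by simp
    rw [Polynomial.eval_mul, this]
    push_cast
    field_simp
  have hpowsum : ∀ m r : ℕ, ∑ x ∈ residues (ℓ ^ r) N t, (x : ℚ) ^ m = (N : ℚ) ^ m *
      (((Polynomial.bernoulli (m + 1)).eval (a + (ℓ : ℚ) ^ r) -
        (Polynomial.bernoulli (m + 1)).eval a) / (m + 1)) := fun m r => by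
    rw [sum_residues hN, sum_range_add_mul_pow_eq_bernoulli_sub hN, ha', Nat.cast_pow]
  have hlim := ((hdd (k + 2)).const_mul ((N : ℚ_[ℓ]) ^ (k + 1))).sub
    ((hpow.mul (hdd (k + 1))).const_mul (((k : ℚ_[ℓ]) + 2) / 2 * (N : ℚ_[ℓ]) ^ (k + 1)))
  rw [zero_mul, mul_zero, sub_zero] at hlim
  rw [Rat.cast_mul, Rat.cast_pow, Rat.cast_natCast]
  push_cast at hlim
  refine hlim.congr fun r => ?_
  have key : ∑ x ∈ residues (ℓ ^ r) N t, mainTerm (ℓ ^ r * N) k x =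
      (∑ x ∈ residues (ℓ ^ r) N t, (x : ℚ) ^ (k + 2)) / ((ℓ : ℚ) ^ r * N) -
        ((k : ℚ) + 2) / 2 * ∑ x ∈ residues (ℓ ^ r) N t, (x : ℚ) ^ (k + 1) := by
    simp [mainTerm, Finset.sum_sub_distrib, Finset.sum_div, Finset.mul_sum]
  rw [key, hpowsum, hpowsum]
  push_cast
  have hN1 : (N : ℚ_[ℓ]) ≠ 0 := by exact_mod_cast (by omega : N ≠ 0)
  have hk1 : (k : ℚ_[ℓ]) + 2 ≠ 0 := by exact_mod_cast (by omega : k + 2 ≠ 0)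
  have hk2 : (k : ℚ_[ℓ]) + 2 + 1 ≠ 0 := by exact_mod_cast (by omega : k + 2 + 1 ≠ 0)
  field_simp
  ring_nf

/-- In `ℚ_ℓ` the sequence `(S_r)` converges to
`(N^{k+1}/(c^k(k+2)))·(c^{k+2}·B_{k+2}({t/N}) − B_{k+2}({ct/N}))`. -/
theorem stmt3 (ℓ : ℕ) [Fact ℓ.Prime] (N : ℕ) (hN : 1 ≤ N) (k : ℕ) (t c : ℤ)
    (hc : Int.gcd c (6 * ℓ) = 1) :
    Filter.Tendsto (fun r => ((S ℓ N k t c r : ℚ) : ℚ_[ℓ])) Filter.atTop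
      (nhds ((((N : ℚ) ^ (k + 1) / ((c : ℚ) ^ k * ((k : ℚ) + 2))) *
        ((c : ℚ) ^ (k + 2) *
            (Polynomial.bernoulli (k + 2)).eval (Int.fract ((t : ℚ) / (N : ℚ))) -
          (Polynomial.bernoulli (k + 2)).eval
            (Int.fract (((c * t : ℤ) : ℚ) / (N : ℚ)))) : ℚ) : ℚ_[ℓ])) := by
  have hℓ : ℓ.Prime := Fact.out
  have hcop : IsCoprime ((6 : ℤ) * ℓ) c := (Int.isCoprime_iff_gcd_eq_one.2 hc).symm
  have hc0 : c ≠ 0 := by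
    rintro rfl
    have := Int.isUnit_iff.1 (isCoprime_zero_right.1 hcop)
    have := hℓ.pos
    omega
  choose Z hZ using S_eq hℓ.one_le hN k t hc0 hcop.of_mul_left_right
  have herr : Filter.Tendsto (fun r => (ℓ : ℚ_[ℓ]) ^ r * (Z r : ℚ_[ℓ])) Filter.atTop (nhds 0) :=
    (tendsto_pow_atTop_nhds_zero_of_norm_lt_one Padic.norm_p_lt_one).zero_mul_isBoundedUnder_le
      (Filter.isBoundedUnder_of ⟨1, fun r => Padic.norm_int_le_one (Z r)⟩)
  have hlim := ((((tendsto_sum_mainTerm ℓ hN k t).const_mul ((c : ℚ_[ℓ]) ^ (k + 2))).sub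
    (tendsto_sum_mainTerm ℓ hN k (c * t))).const_mul (1 / ((c : ℚ_[ℓ]) ^ k * (k + 2)))).add
    (herr.const_mul ((N : ℚ_[ℓ]) / (12 * ((c : ℚ_[ℓ]) ^ k * (k + 2)))))
  convert hlim using 1
  · funext r
    rw [hZ r]
    push_cast
    ring
  · congr 1
    push_cast
    ring
end

section
/- Let K be an algebraically closed field, let n ≥ 1 be an integer that is nonzero in K (i.e. the characteristic of K does not divide n), and let c ≥ 1 be an integer with gcd(c, n) = 1. Let z ∈ K with z ≠ 0 and z^c ≠ 1. Then every w ∈ K with wⁿ = z satisfies w^c ≠ 1, and the product over the finite set {w ∈ K : wⁿ = z} of (1 − w)^{c²}/(1 − w^c) equals (1 − z)^{c²}/(1 − z^c). -/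
open Polynomial in
/-- The roots of `X ^ n - z`, for `n` and `z` nonzero in the field, are simple. -/
theorem val_eq_roots_X_pow_sub_C {K : Type*} [Field K] {n : ℕ} (hnK : (n : K) ≠ 0) {z : K}
    (hz : z ≠ 0) {s : Finset K} (hs : ∀ w : K, w ∈ s ↔ w ^ n = z) :
    s.val = (X ^ n - C z : K[X]).roots := by
  have hn : n ≠ 0 := by
    rintro rfl
    simp at hnK
  refine (Multiset.Nodup.ext s.nodup (nodup_roots (separable_X_pow_sub_C z hnK hz))).2 fun w => ?_
  rw [Finset.mem_val, hs, mem_roots (X_pow_sub_C_ne_zero (Nat.pos_of_ne_zero hn) z)]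
  simp [sub_eq_zero]

open Polynomial in
theorem card_eq_of_mem_iff_pow_eq {K : Type*} [Field K] [IsAlgClosed K] {n : ℕ}
    (hnK : (n : K) ≠ 0) {z : K} (hz : z ≠ 0) {s : Finset K} (hs : ∀ w : K, w ∈ s ↔ w ^ n = z) :
    s.card = n := by
  rw [Finset.card_def, val_eq_roots_X_pow_sub_C hnK hz hs,
    ← (IsAlgClosed.splits _).natDegree_eq_card_roots, natDegree_X_pow_sub_C]

open Polynomial in
theorem prod_sub_eq_pow_sub {K : Type*} [Field K] [IsAlgClosed K] {n : ℕ}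
    (hnK : (n : K) ≠ 0) {z : K} (hz : z ≠ 0) {s : Finset K} (hs : ∀ w : K, w ∈ s ↔ w ^ n = z)
    (x : K) : ∏ w ∈ s, (x - w) = x ^ n - z := by
  have hn : n ≠ 0 := by
    rintro rfl
    simp at hnK
  have h := (IsAlgClosed.splits (X ^ n - C z : K[X])).eq_prod_roots
  rw [(monic_X_pow_sub_C z hn).leadingCoeff, ← val_eq_roots_X_pow_sub_C hnK hz hs, C_1,
    one_mul] at h
  have h2 := congrArg (eval x) h
  change _ = eval x (∏ w ∈ s, (X - C w)) at h2
  simpa [eval_prod] using h2.symm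

theorem eq_of_pow_eq_pow_of_coprime {K : Type*} [Field K] {m n : ℕ} (hmn : Nat.gcd m n = 1)
    {v w : K} (hv : v ≠ 0) (hm : w ^ m = v ^ m) (hn : w ^ n = v ^ n) : w = v := by
  have h : (w / v) ^ Nat.gcd m n = 1 := by
    rw [pow_gcd_eq_one]
    simp [div_pow, hm, hn, hv]
  rwa [hmn, pow_one, div_eq_one_iff_eq hv] at h


/-- Norm-compatibility of `_cΞ(z) = (1 − z)^{c²}/(1 − z^c)` under the `n`-th power map:
over an algebraically closed field in which `n` is invertible, if `z ≠ 0` and `z^c ≠ 1`,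
then every `n`-th root `w` of `z` satisfies `w^c ≠ 1`, and the product of
`(1 − w)^{c²}/(1 − w^c)` over the finite set of `n`-th roots of `z` equals
`(1 − z)^{c²}/(1 − z^c)`. -/
theorem stmt6 (K : Type*) [Field K] [IsAlgClosed K] (n c : ℕ) (hn : 1 ≤ n)
    (hnK : (n : K) ≠ 0) (hc : 1 ≤ c) (hcn : Nat.gcd c n = 1) (z : K) (hz : z ≠ 0)
    (hzc : z ^ c ≠ 1) (s : Finset K) (hs : ∀ w : K, w ∈ s ↔ w ^ n = z) :
    (∀ w ∈ s, w ^ c ≠ 1) ∧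
      ∏ w ∈ s, (1 - w) ^ (c ^ 2) / (1 - w ^ c) = (1 - z) ^ (c ^ 2) / (1 - z ^ c) := by
  classical
  have ne_zero : ∀ w ∈ s, w ≠ 0 := by
    rintro w hw rfl
    rw [hs, zero_pow (by omega)] at hw
    exact hz hw.symm
  have inj : Set.InjOn (fun w : K => w ^ c) s := fun w hw v hv h =>
    eq_of_pow_eq_pow_of_coprime hcn (ne_zero v hv) h (((hs w).1 hw).trans ((hs v).1 hv).symm)
  have mem_image : ∀ u : K, u ∈ s.image (fun w => w ^ c) ↔ u ^ n = z ^ c := by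
    have hzc0 : z ^ c ≠ 0 := pow_ne_zero c hz
    have hr : ∀ u : K, u ∈ Polynomial.nthRootsFinset n (z ^ c) ↔ u ^ n = z ^ c := fun u =>
      Polynomial.mem_nthRootsFinset hn _
    have heq : s.image (fun w => w ^ c) = Polynomial.nthRootsFinset n (z ^ c) := by
      refine Finset.eq_of_subset_of_card_le (fun u hu => ?_) ?_
      · obtain ⟨w, hw, rfl⟩ := Finset.mem_image.1 hu
        rw [hr, pow_right_comm, (hs w).1 hw]
      · rw [Finset.card_image_of_injOn inj, card_eq_of_mem_iff_pow_eq hnK hz hs,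
          card_eq_of_mem_iff_pow_eq hnK hzc0 hr]
    rwa [heq]
  refine ⟨fun w hw h => hzc ?_, ?_⟩
  · rw [← (hs w).1 hw, pow_right_comm, h, one_pow]
  · have hden := prod_sub_eq_pow_sub hnK (pow_ne_zero c hz) mem_image 1
    rw [Finset.prod_image inj, one_pow] at hden
    rw [Finset.prod_div_distrib, Finset.prod_pow, prod_sub_eq_pow_sub hnK hz hs, one_pow, hden]
end

section
/- Let ℓ be a prime and let X be a profinite space (a nonempty compact Hausdorff totally disconnected topological space). Let ℤ_ℓ denote the ring of ℓ-adic integers with its topology. Then the ℤ_ℓ-linear map from the ℤ_ℓ-module of ℤ_ℓ-linear maps C(X, ℤ_ℓ) → ℤ_ℓ to the ℤ_ℓ-module of ℤ_ℓ-linear maps LocallyConstant(X, ℤ_ℓ) → ℤ_ℓ, given by precomposition with the inclusion of locally constant functions into continuous functions, is bijective. -/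
namespace PadicInt

variable {p : ℕ} [Fact p.Prime]

theorem dvd_iff_norm_le {a b : ℤ_[p]} : a ∣ b ↔ ‖b‖ ≤ ‖a‖ := by
  rcases eq_or_ne a 0 with rfl | ha
  · simp
  · rw [norm_eq_zpow_neg_valuation ha, norm_le_pow_iff_mem_span_pow, Ideal.mem_span_singleton]
    conv_lhs => rw [unitCoeff_spec ha]
    exact Units.mul_left_dvd

theorem isInducing_mul_left {a : ℤ_[p]} (ha : a ≠ 0) :
    Topology.IsInducing fun x : ℤ_[p] => a * x :=
  ((continuous_const_mul a).isClosedEmbedding (mul_right_injective₀ ha)).isInducing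

end PadicInt

namespace ContinuousMap

variable {p : ℕ} [Fact p.Prime] {X : Type*} [TopologicalSpace X]

theorem exists_eq_smul_of_dvd {f : C(X, ℤ_[p])} {a : ℤ_[p]} (ha : a ≠ 0) (h : ∀ x, a ∣ f x) :
    ∃ g : C(X, ℤ_[p]), f = a • g := by
  choose g hg using h
  refine ⟨⟨g, (PadicInt.isInducing_mul_left ha).continuous_iff.2 ?_⟩, ext hg⟩
  simpa only [Function.comp_def, ← hg] using f.continuous

variable [CompactSpace X]

theorem exists_norm_eq_norm_apply [Nonempty X] {E : Type*} [SeminormedAddCommGroup E]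
    (f : C(X, E)) : ∃ x, ‖f‖ = ‖f x‖ := by
  obtain ⟨x, -, hx⟩ := isCompact_univ.exists_isMaxOn Set.univ_nonempty
    (f := fun x => ‖f x‖) (by fun_prop)
  exact ⟨x, le_antisymm ((norm_le_of_nonempty f).2 fun y => hx (Set.mem_univ y))
    (f.norm_coe_le_norm x)⟩

/-- A `ℤ_p`-linear functional on `C(X, ℤ_p)` does not increase the supremum norm. -/
theorem norm_linearMap_apply_le [Nonempty X] (φ : C(X, ℤ_[p]) →ₗ[ℤ_[p]] ℤ_[p])
    (f : C(X, ℤ_[p])) : ‖φ f‖ ≤ ‖f‖ := by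
  rcases eq_or_ne f 0 with rfl | hf
  · simp
  obtain ⟨x, hx⟩ := f.exists_norm_eq_norm_apply
  have ha : f x ≠ 0 := norm_ne_zero_iff.1 (hx ▸ norm_ne_zero_iff.2 hf)
  obtain ⟨g, hg⟩ := exists_eq_smul_of_dvd ha fun y =>
    PadicInt.dvd_iff_norm_le.2 ((f.norm_coe_le_norm y).trans_eq hx)
  calc ‖φ f‖ = ‖f x • φ g‖ := by rw [← map_smul, ← hg]
    _ ≤ ‖f‖ := by
      rw [smul_eq_mul, norm_mul, hx]
      exact mul_le_of_le_one_right (norm_nonneg _) (PadicInt.norm_le_one _)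

end ContinuousMap

namespace LocallyConstant

variable {p : ℕ} [Fact p.Prime] {X : Type*} [TopologicalSpace X]

theorem exists_eq_smul_of_dvd {R : Type*} [CommSemiring R] {f : LocallyConstant X R} {a : R}
    (h : ∀ x, a ∣ f x) : ∃ g : LocallyConstant X R, f = a • g := by
  classical
  choose k hk using fun (y : R) (hy : a ∣ y) => hy
  refine ⟨f.map fun y => if hy : a ∣ y then k y hy else 0, ext fun x => ?_⟩
  simpa [h x] using hk (f x) (h x)

variable [CompactSpace X]

/-- A `ℤ_p`-linear functional on locally constant functions does not increase the supremum
norm. -/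
theorem norm_linearMap_apply_le [Nonempty X] (φ : LocallyConstant X ℤ_[p] →ₗ[ℤ_[p]] ℤ_[p])
    (f : LocallyConstant X ℤ_[p]) : ‖φ f‖ ≤ ‖toContinuousMapLinearMap ℤ_[p] f‖ := by
  obtain ⟨x, hx⟩ := (toContinuousMapLinearMap ℤ_[p] f).exists_norm_eq_norm_apply
  obtain ⟨g, hg⟩ := exists_eq_smul_of_dvd (f := f) (a := f x) fun y =>
    PadicInt.dvd_iff_norm_le.2
      (((toContinuousMapLinearMap ℤ_[p] f).norm_coe_le_norm y).trans_eq hx)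
  calc ‖φ f‖ = ‖f x • φ g‖ := by rw [← map_smul, ← hg]
    _ ≤ ‖toContinuousMapLinearMap ℤ_[p] f‖ := by
      rw [smul_eq_mul, norm_mul, hx]
      exact mul_le_of_le_one_right (norm_nonneg _) (PadicInt.norm_le_one _)

theorem denseRange_toContinuousMapLinearMap :
    DenseRange
      (toContinuousMapLinearMap ℤ_[p] : LocallyConstant X ℤ_[p] →ₗ[ℤ_[p]] C(X, ℤ_[p])) := by
  refine Metric.denseRange_iff.2 fun f ε hε => ?_
  obtain ⟨n, hn⟩ := PadicInt.exists_pow_neg_lt p hε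
  let I : Ideal ℤ_[p] := Ideal.span {(p : ℤ_[p]) ^ n}
  have hmk : IsLocallyConstant fun x => Ideal.Quotient.mk I (f x) := by
    refine (IsLocallyConstant.iff_eventually_eq _).2 fun x => ?_
    have hpos : (0 : ℝ) < (p : ℝ) ^ (-n : ℤ) :=
      zpow_pos (mod_cast (Fact.out : p.Prime).pos) _
    filter_upwards [f.continuous.continuousAt.eventually (Metric.ball_mem_nhds (f x) hpos)]
      with y hy
    rw [Ideal.Quotient.eq, ← PadicInt.norm_le_pow_iff_mem_span_pow, ← dist_eq_norm]
    exact (Metric.mem_ball.1 hy).le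
  let g : LocallyConstant X ℤ_[p] := (⟨_, hmk⟩ : LocallyConstant X (ℤ_[p] ⧸ I)).map Quotient.out
  refine ⟨g, lt_of_le_of_lt ((ContinuousMap.dist_le (by positivity)).2 fun x => ?_) hn⟩
  rw [dist_eq_norm, PadicInt.norm_le_pow_iff_mem_span_pow, ← Ideal.Quotient.eq]
  exact (Quotient.out_eq _).symm

end LocallyConstant

/-- A linear map into a complete module that is bounded along a linear map with dense range
extends along it, over an arbitrary ring of scalars. -/
theorem LinearMap.exists_comp_eq_of_denseRange {R E E' F : Type*} [Ring R]
    [AddCommGroup E] [Module R E]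
    [SeminormedAddCommGroup E'] [Module R E'] [ContinuousConstSMul R E']
    [NormedAddCommGroup F] [Module R F] [ContinuousConstSMul R F] [CompleteSpace F]
    {e : E →ₗ[R] E'} (he : DenseRange e) (f : E →ₗ[R] F) (hf : ∀ x, ‖f x‖ ≤ ‖e x‖) :
    ∃ g : E' →ₗ[R] F, g.comp e = f := by
  let : SeminormedAddCommGroup E := SeminormedAddCommGroup.induced E E' e
  have hind : IsUniformInducing e := ⟨rfl⟩
  let fL : E →L[R] F :=
    ⟨f, AddMonoidHomClass.continuous_of_bound f 1 fun x => (hf x).trans_eq (one_mul _).symm⟩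
  let eL : E →L[R] E' := ⟨e, hind.uniformContinuous.continuous⟩
  exact ⟨(fL.extend eL).toLinearMap, LinearMap.ext fun x => fL.extend_eq (e := eL) he hind x⟩

/-- For a profinite space `X`, a `ℤ_ℓ`-valued measure on `X` (that is, a `ℤ_ℓ`-linear
functional on `C(X, ℤ_ℓ)`) is uniquely determined by, and can be constructed from, its
restriction to locally constant functions: precomposition with the inclusion
`LocallyConstant X ℤ_ℓ → C(X, ℤ_ℓ)` is bijective on `ℤ_ℓ`-linear functionals. -/
theorem stmt8 (ℓ : ℕ) [Fact ℓ.Prime] (X : Type*) [TopologicalSpace X] [CompactSpace X]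
    [T2Space X] [TotallyDisconnectedSpace X] [Nonempty X] :
    Function.Bijective
      (fun φ : C(X, ℤ_[ℓ]) →ₗ[ℤ_[ℓ]] ℤ_[ℓ] =>
        φ.comp (LocallyConstant.toContinuousMapLinearMap ℤ_[ℓ])) := by
  have hdense := LocallyConstant.denseRange_toContinuousMapLinearMap (p := ℓ) (X := X)
  refine ⟨fun φ ψ h => ?_, fun φ => ?_⟩
  · have hcont (θ : C(X, ℤ_[ℓ]) →ₗ[ℤ_[ℓ]] ℤ_[ℓ]) : Continuous θ :=
      AddMonoidHomClass.continuous_of_bound θ 1 fun f => by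
        simpa using ContinuousMap.norm_linearMap_apply_le θ f
    exact DFunLike.coe_injective
      (hdense.equalizer (hcont φ) (hcont ψ) (congrArg DFunLike.coe h))
  · exact LinearMap.exists_comp_eq_of_denseRange hdense φ
      (LocallyConstant.norm_linearMap_apply_le φ)
end
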